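/- For integers k > ℓ ≥ 1 and n with 2k ≤ n ≤ 3k−ℓ, one has g(n,k,ℓ) = C(n−1,k+ℓ−1)·C(k+ℓ−1,ℓ). -/

import Mathlib

/-- `v` is a `{0,1,-1}`-vector of length `n` with exactly `k` coordinates equal to `+1`
and exactly `l` coordinates equal to `-1`, i.e. `v ∈ V(n,k,l)`. -/
def IsPMVec (n k l : ℕ) (v : Fin n → ℤ) : Prop :=
  (∀ i, v i = 0 ∨ v i = 1 ∨ v i = -1) ∧
  (Finset.univ.filter fun i => v i = 1).card = k ∧
  (Finset.univ.filter fun i => v i = -1).card = l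

/-- the standard scalar product -/
def dotZ {n : ℕ} (v w : Fin n → ℤ) : ℤ := ∑ i, v i * w i

/-- `g(n,k,l)`: the maximum size of a family `V ⊆ V(n,k,l)` with
`⟨v,w⟩ > -2l` for all `v, w ∈ V`. -/
noncomputable def gVal (n k l : ℕ) : ℕ :=
  sSup {m | ∃ F : Finset (Fin n → ℤ),
    (∀ v ∈ F, IsPMVec n k l v) ∧
    (∀ v ∈ F, ∀ w ∈ F, -2 * (l : ℤ) < dotZ v w) ∧ F.card = m}

open Finset

section PMVec

variable {n k l : ℕ}

open Classical in
/-- The set `V(n,k,l)` as a finset. -/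
noncomputable def pmVecs (n k l : ℕ) : Finset (Fin n → ℤ) :=
  (Fintype.piFinset fun _ => ({0, 1, -1} : Finset ℤ)).filter (IsPMVec n k l)

theorem mem_pmVecs {v : Fin n → ℤ} : v ∈ pmVecs n k l ↔ IsPMVec n k l v := by
  simp only [pmVecs, mem_filter, Fintype.mem_piFinset, mem_insert, mem_singleton,
    and_iff_right_iff_imp]
  exact fun h => h.1

theorem IsPMVec.card_ne_zero {v : Fin n → ℤ} (h : IsPMVec n k l v) :
    (univ.filter fun i => v i ≠ 0).card = k + l := by
  rw [← h.2.1, ← h.2.2, ← card_union_of_disjoint]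
  · congr 1
    ext i
    have := h.1 i
    simp only [mem_filter, mem_univ, true_and, mem_union]
    omega
  · rw [disjoint_filter]
    intro i _ h1 h2
    omega

theorem card_pmVecs (n k l : ℕ) :
    (pmVecs n k l).card = n.choose (k + l) * (k + l).choose l := by
  have hcard : ((powersetCard (k + l) (univ : Finset (Fin n))).sigma
      fun S => powersetCard l S).card = n.choose (k + l) * (k + l).choose l := by
    rw [card_sigma, sum_congr rfl (g := fun _ => (k + l).choose l)]
    · simp
    · intro S hS
      rw [card_powersetCard, (mem_powersetCard.1 hS).2]
  rw [← hcard]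
  refine card_nbij' (fun v => ⟨univ.filter fun i => v i ≠ 0, univ.filter fun i => v i = -1⟩)
    (fun p i => if i ∈ p.2 then -1 else if i ∈ p.1 then 1 else 0) ?_ ?_ ?_ ?_
  · intro v hv
    have hv := mem_pmVecs.1 hv
    simp only [coe_sigma, Set.mem_sigma_iff, mem_coe, mem_powersetCard]
    refine ⟨⟨subset_univ _, hv.card_ne_zero⟩, ?_, hv.2.2⟩
    intro i
    simp only [mem_filter, mem_univ, true_and]
    omega
  · rintro ⟨S, N⟩ h
    simp only [coe_sigma, Set.mem_sigma_iff, mem_coe, mem_powersetCard] at h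
    obtain ⟨⟨-, hS⟩, hNS, hN⟩ := h
    refine mem_pmVecs.2 ⟨fun i => ?_, ?_, ?_⟩
    · dsimp only
      split_ifs <;> simp
    · have : (univ.filter fun i => (if i ∈ N then (-1 : ℤ) else if i ∈ S then 1 else 0) = 1)
          = S \ N := by
        ext i
        simp only [mem_filter, mem_univ, true_and, mem_sdiff]
        split_ifs <;> simp_all
      rw [this, card_sdiff_of_subset hNS]
      omega
    · have : (univ.filter fun i => (if i ∈ N then (-1 : ℤ) else if i ∈ S then 1 else 0) = -1)
          = N := by
        ext i
        simp only [mem_filter, mem_univ, true_and]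
        split_ifs <;> simp_all
      rw [this, hN]
  · intro v hv
    have hv := mem_pmVecs.1 hv
    funext i
    have := hv.1 i
    simp only [mem_filter, mem_univ, true_and]
    split_ifs <;> omega
  · rintro ⟨S, N⟩ h
    simp only [coe_sigma, Set.mem_sigma_iff, mem_coe, mem_powersetCard] at h
    obtain ⟨-, hNS, -⟩ := h
    have h1 : (univ.filter fun i => (if i ∈ N then (-1 : ℤ) else if i ∈ S then 1 else 0) ≠ 0)
        = S := by
      ext i
      have := @hNS i
      simp only [mem_filter, mem_univ, true_and]
      split_ifs <;> simp_all
    have h2 : (univ.filter fun i => (if i ∈ N then (-1 : ℤ) else if i ∈ S then 1 else 0) = -1)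
        = N := by
      ext i
      simp only [mem_filter, mem_univ, true_and]
      split_ifs <;> simp_all
    dsimp only
    rw [h1, h2]

theorem IsPMVec.comp_perm {v : Fin n → ℤ} (h : IsPMVec n k l v) (σ : Equiv.Perm (Fin n)) :
    IsPMVec n k l (v ∘ σ) := by
  have key (c : ℤ) : (univ.filter fun i => (v ∘ σ) i = c).card
      = (univ.filter fun i => v i = c).card :=
    card_equiv σ (by simp)
  exact ⟨fun i => h.1 _, (key 1).trans h.2.1, (key (-1)).trans h.2.2⟩

theorem IsPMVec.exists_perm {v w : Fin n → ℤ} (hv : IsPMVec n k l v) (hw : IsPMVec n k l w) :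
    ∃ σ : Equiv.Perm (Fin n), v ∘ σ = w := by
  have key (c : ℤ) : (univ.filter fun i => w i = c).card
      = (univ.filter fun i => v i = c).card := by
    by_cases h1 : c = 1
    · rw [h1, hw.2.1, hv.2.1]
    by_cases h2 : c = -1
    · rw [h2, hw.2.2, hv.2.2]
    by_cases h0 : c = 0
    · have e1 := card_filter_add_card_filter_not (s := univ) (fun i => v i = 0)
      have e2 := card_filter_add_card_filter_not (s := univ) (fun i => w i = 0)
      have e3 := hv.card_ne_zero
      have e4 := hw.card_ne_zero
      simp only [ne_eq] at e3 e4
      rw [h0]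
      omega
    · rw [filter_false_of_mem, filter_false_of_mem]
      · intro i _
        have := hv.1 i
        omega
      · intro i _
        have := hw.1 i
        omega
  have e (c : ℤ) : Nonempty ({i // w i = c} ≃ {i // v i = c}) := by
    rw [← Fintype.card_eq, Fintype.card_subtype, Fintype.card_subtype]
    exact key c
  exact ⟨Equiv.ofFiberEquiv fun c => (e c).some, funext fun i => Equiv.ofFiberEquiv_map _ i⟩

/-- A uniformly random coordinate permutation of `u ∈ V(n,k,l)` is uniform on `V(n,k,l)`. -/
theorem IsPMVec.card_perm_mul {u : Fin n → ℤ} (hu : IsPMVec n k l u)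
    {F : Finset (Fin n → ℤ)} (hF : F ⊆ pmVecs n k l) :
    (univ.filter fun σ : Equiv.Perm (Fin n) => u ∘ σ ∈ F).card * (pmVecs n k l).card
      = F.card * n.factorial := by
  set c := (univ.filter fun σ : Equiv.Perm (Fin n) => u ∘ σ = u).card
  have fiber {w : Fin n → ℤ} (hw : w ∈ pmVecs n k l) :
      (univ.filter fun σ : Equiv.Perm (Fin n) => u ∘ σ = w).card = c := by
    obtain ⟨τ, rfl⟩ := hu.exists_perm (mem_pmVecs.1 hw)
    refine card_equiv (Equiv.mulRight τ⁻¹) fun σ => ?_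
    simp only [mem_filter, mem_univ, true_and, Equiv.coe_mulRight, funext_iff,
      Function.comp_apply, Equiv.Perm.mul_apply]
    refine ⟨fun h i => by simp [h], fun h i => by simpa using h (τ i)⟩
  have count {G : Finset (Fin n → ℤ)} (hG : G ⊆ pmVecs n k l) :
      (univ.filter fun σ : Equiv.Perm (Fin n) => u ∘ σ ∈ G).card = G.card * c := by
    rw [card_eq_sum_card_fiberwise (f := fun σ : Equiv.Perm (Fin n) => u ∘ σ) (t := G)
      (fun σ hσ => by simpa using hσ), sum_const_nat]
    intro w hw
    rw [← fiber (hG hw), filter_filter]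
    congr 1
    ext σ
    simp only [mem_filter, mem_univ, true_and, and_iff_right_iff_imp]
    rintro rfl
    exact hw
  have total := count (subset_refl (pmVecs n k l))
  rw [filter_true_of_mem fun σ _ => mem_pmVecs.2 (hu.comp_perm σ), card_univ,
    Fintype.card_perm, Fintype.card_fin] at total
  rw [count hF, total]
  ring

/-- Katona's cycle bound: pairwise intersecting arcs of length `k` on a cycle of length
`n ≥ 2k`, recorded by their starting points, number at most `k`. -/
theorem card_le_of_cyclic_diff [NeZero n] (hn : 2 * k ≤ n) {S : Finset (Fin n)}
    (hS : ∀ s ∈ S, ∀ t ∈ S, ¬(k ≤ (t - s).val ∧ (t - s).val ≤ n - k)) : S.card ≤ k := by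
  obtain rfl | ⟨a, ha⟩ := S.eq_empty_or_nonempty
  · simp
  have diff {s t : Fin n} (h : (s - a).val ≤ (t - a).val) :
      (t - s).val = (t - a).val - (s - a).val := by
    rw [← Fin.sub_val_of_le h, sub_sub_sub_cancel_right]
  rw [← card_range k]
  refine card_le_card_of_injOn
    (fun s => if (s - a).val < k then (s - a).val else (s - a).val - (n - k)) ?_ ?_
  · intro s hs
    have h1 := hS a ha s hs
    have h2 := (s - a).isLt
    simp only [coe_range, Set.mem_Iio]
    split_ifs <;> omega
  · intro s hs t ht hst
    have h1 := hS a ha s hs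
    have h2 := hS a ha t ht
    have h3 := hS s hs t ht
    have h4 := hS t ht s hs
    have d1 := diff (s := s) (t := t)
    have d2 := diff (s := t) (t := s)
    have : (s - a).val = (t - a).val := by
      dsimp only at hst
      split_ifs at hst <;> omega
    exact sub_left_injective (Fin.ext this)

/-- The cyclic pattern: `k` ones, then zeros, then an arc of `l` minus ones at `n - k`. -/
def arcVec (n k l : ℕ) (i : Fin n) : ℤ :=
  if i.val < k then 1 else if n - k ≤ i.val ∧ i.val < n - k + l then -1 else 0

theorem isPMVec_arcVec (hlk : l ≤ k) (hn : 2 * k ≤ n) : IsPMVec n k l (arcVec n k l) := by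
  refine ⟨fun i => by unfold arcVec; split_ifs <;> simp, ?_, ?_⟩
  · refine (card_nbij (t := range k) (fun i => i.val) ?_ Fin.val_injective.injOn ?_).trans
      (card_range k)
    · intro i hi
      simp only [coe_filter, mem_univ, true_and, Set.mem_ofPred_eq] at hi
      unfold arcVec at hi
      split_ifs at hi <;> simp_all
    · intro i hi
      have hi : i < k := by simpa using hi
      exact ⟨⟨i, by omega⟩, by simp [arcVec, hi], rfl⟩
  · refine (card_nbij (t := Ico (n - k) (n - k + l)) (fun i => i.val) ?_
      Fin.val_injective.injOn ?_).trans (by simp)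
    · intro i hi
      simp only [coe_filter, mem_univ, true_and, Set.mem_ofPred_eq] at hi
      unfold arcVec at hi
      split_ifs at hi <;> simp_all
    · intro i hi
      have hi : n - k ≤ i ∧ i < n - k + l := by simpa using hi
      have h' : ¬ i < k := by omega
      refine ⟨⟨i, by omega⟩, ?_, rfl⟩
      simp only [coe_filter, mem_univ, true_and, Set.mem_ofPred_eq]
      unfold arcVec
      rw [if_neg h', if_pos hi]

theorem sum_indicator_neg_one {v : Fin n → ℤ} (h : IsPMVec n k l v) :
    ∑ i, (if v i = -1 then (1 : ℤ) else 0) = l := by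
  rw [sum_boole, h.2.2]

theorem dotZ_arcVec_shift_le [NeZero n] (hlk : l ≤ k) (hn1 : 2 * k ≤ n) (hn2 : n + l ≤ 3 * k)
    {d : Fin n} (hd1 : k ≤ d.val) (hd2 : d.val ≤ n - k) :
    dotZ (arcVec n k l ∘ Equiv.addRight d) (arcVec n k l) ≤ -2 * (l : ℤ) := by
  have hu := isPMVec_arcVec hlk hn1
  have h1 := sum_indicator_neg_one hu
  have h2 := sum_indicator_neg_one (hu.comp_perm (Equiv.addRight d))
  have : dotZ (arcVec n k l ∘ Equiv.addRight d) (arcVec n k l)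
      ≤ ∑ i, (-(if (arcVec n k l ∘ Equiv.addRight d) i = -1 then (1 : ℤ) else 0)
        - (if arcVec n k l i = -1 then (1 : ℤ) else 0)) := by
    refine sum_le_sum fun i _ => ?_
    have hi := i.isLt
    have hv := Fin.val_add_eq_ite i d
    simp only [arcVec, Function.comp_apply, Equiv.coe_addRight]
    split_ifs at hv ⊢ <;> first | omega | simp_all
  rw [sum_sub_distrib, sum_neg_distrib, h1, h2] at this
  linarith

theorem dotZ_comp_perm (v w : Fin n → ℤ) (σ : Equiv.Perm (Fin n)) :
    dotZ (v ∘ σ) (w ∘ σ) = dotZ v w :=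
  Equiv.sum_comp σ fun i => v i * w i

/-- Averaging Katona's cycle bound over all arrangements. -/
theorem mul_card_le_mul_card_pmVecs [NeZero n] (hlk : l ≤ k) (hn1 : 2 * k ≤ n)
    (hn2 : n + l ≤ 3 * k) {F : Finset (Fin n → ℤ)} (hF : F ⊆ pmVecs n k l)
    (hdot : ∀ v ∈ F, ∀ w ∈ F, -2 * (l : ℤ) < dotZ v w) :
    n * F.card ≤ k * (pmVecs n k l).card := by
  have hu := isPMVec_arcVec hlk hn1
  let v (s : Fin n) : Fin n → ℤ := arcVec n k l ∘ Equiv.subRight s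
  have cycle (σ : Equiv.Perm (Fin n)) : (univ.filter fun s => v s ∘ σ ∈ F).card ≤ k := by
    refine card_le_of_cyclic_diff hn1 fun s hs t ht hd => ?_
    refine (hdot _ (mem_filter.1 hs).2 _ (mem_filter.1 ht).2).not_ge ?_
    rw [dotZ_comp_perm]
    have := dotZ_arcVec_shift_le hlk hn1 hn2 hd.1 hd.2
    rw [← dotZ_comp_perm _ _ (Equiv.subRight t)] at this
    have hvs : (arcVec n k l ∘ Equiv.addRight (t - s)) ∘ Equiv.subRight t = v s := by
      funext i
      simp [v]
    rwa [hvs] at this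
  have swap := sum_card_bipartiteAbove_eq_sum_card_bipartiteBelow (s := univ) (t := univ)
    (fun (s : Fin n) (σ : Equiv.Perm (Fin n)) => v s ∘ σ ∈ F)
  simp only [bipartiteAbove, bipartiteBelow] at swap
  have bound : ∑ s, (univ.filter fun σ : Equiv.Perm (Fin n) => v s ∘ σ ∈ F).card
      ≤ n.factorial * k := by
    rw [swap]
    refine (sum_le_card_nsmul _ _ k fun σ _ => cycle σ).trans_eq ?_
    rw [card_univ, Fintype.card_perm, Fintype.card_fin, smul_eq_mul]
  have total : (∑ s, (univ.filter fun σ : Equiv.Perm (Fin n) => v s ∘ σ ∈ F).card)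
      * (pmVecs n k l).card = n * (F.card * n.factorial) := by
    rw [sum_mul, sum_congr rfl fun s _ => (hu.comp_perm (Equiv.subRight s)).card_perm_mul hF]
    simp
  refine Nat.le_of_mul_le_mul_left ?_ n.factorial_pos
  calc n.factorial * (n * F.card) = n * (F.card * n.factorial) := by ring
    _ ≤ n.factorial * k * (pmVecs n k l).card := total ▸ Nat.mul_le_mul_right _ bound
    _ = n.factorial * (k * (pmVecs n k l).card) := by ring

theorem mul_card_pmVecs_star [NeZero n] :
    n * ((pmVecs n k l).filter fun v => v 0 = 1).card = k * (pmVecs n k l).card := by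
  have swap := sum_card_bipartiteAbove_eq_sum_card_bipartiteBelow (s := univ) (t := pmVecs n k l)
    (fun (i : Fin n) (v : Fin n → ℤ) => v i = 1)
  simp only [bipartiteAbove, bipartiteBelow] at swap
  rw [sum_const_nat (m := k) fun v hv => (mem_pmVecs.1 hv).2.1,
    sum_const_nat (m := ((pmVecs n k l).filter fun v => v 0 = 1).card)] at swap
  · rw [card_univ, Fintype.card_fin] at swap
    rw [swap, mul_comm]
  · intro i _
    refine card_nbij' (· ∘ Equiv.swap 0 i) (· ∘ Equiv.swap 0 i) ?_ ?_ ?_ ?_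
    · intro v hv
      simp only [coe_filter, Set.mem_ofPred_eq, mem_pmVecs] at hv ⊢
      exact ⟨hv.1.comp_perm _, by simp [hv.2]⟩
    · intro v hv
      simp only [coe_filter, Set.mem_ofPred_eq, mem_pmVecs] at hv ⊢
      exact ⟨hv.1.comp_perm _, by simp [hv.2]⟩
    all_goals
      intro v _
      funext j
      simp

theorem mul_choose_mul_choose (hk : 1 ≤ k) (hn : 1 ≤ n) :
    n * ((n - 1).choose (k + l - 1) * (k + l - 1).choose l)
      = k * (n.choose (k + l) * (k + l).choose l) := by
  obtain ⟨m, rfl⟩ := Nat.exists_eq_add_of_le' hn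
  obtain ⟨j, rfl⟩ := Nat.exists_eq_add_of_le' hk
  have e : j + 1 + l = j + l + 1 := by ring
  rw [e, Nat.add_sub_cancel, Nat.add_sub_cancel]
  have h1 := Nat.add_one_mul_choose_eq m (j + l)
  have h2 := Nat.add_one_mul_choose_eq (j + l) j
  rw [Nat.choose_symm_add, ← Nat.choose_symm_of_eq_add (a := l) (by ring : j + l + 1 = l + (j + 1))]
    at h2
  calc (m + 1) * (m.choose (j + l) * (j + l).choose l)
      = (m + 1) * m.choose (j + l) * (j + l).choose l := by ring
    _ = (m + 1).choose (j + l + 1) * ((j + l + 1) * (j + l).choose l) := by rw [h1]; ring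
    _ = (j + 1) * ((m + 1).choose (j + l + 1) * (j + l + 1).choose l) := by rw [h2]; ring

theorem neg_two_mul_lt_dotZ {v w : Fin n → ℤ} (hv : IsPMVec n k l v) (hw : IsPMVec n k l w)
    {a : Fin n} (hva : v a = 1) (hwa : w a = 1) : -2 * (l : ℤ) < dotZ v w := by
  have : ∑ i, (-(if v i = -1 then (1 : ℤ) else 0) - (if w i = -1 then (1 : ℤ) else 0))
      < dotZ v w := by
    refine sum_lt_sum (fun i _ => ?_) ⟨a, mem_univ _, by simp [hva, hwa]⟩
    rcases hv.1 i with h | h | h <;> rcases hw.1 i with h' | h' | h' <;> simp [h, h']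
  rw [sum_sub_distrib, sum_neg_distrib, sum_indicator_neg_one hv, sum_indicator_neg_one hw] at this
  linarith

end PMVec

/-- For integers `k > l ≥ 1` and `2k ≤ n ≤ 3k - l`,
one has `g(n,k,l) = C(n-1,k+l-1)·C(k+l-1,l)`. -/
theorem stmt_4 (k l n : ℕ) (hl : 1 ≤ l) (hlk : l < k) (hn1 : 2 * k ≤ n)
    (hn2 : n ≤ 3 * k - l) :
    gVal n k l = Nat.choose (n - 1) (k + l - 1) * Nat.choose (k + l - 1) l := by
  have hn : 0 < n := by omega
  have : NeZero n := ⟨hn.ne'⟩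
  have hA := mul_choose_mul_choose (n := n) (k := k) (l := l) (by omega) hn
  rw [← card_pmVecs] at hA
  refine IsGreatest.csSup_eq ⟨⟨(pmVecs n k l).filter fun v => v 0 = 1, ?_, ?_, ?_⟩, ?_⟩
  · intro v hv
    exact mem_pmVecs.1 (mem_filter.1 hv).1
  · intro v hv w hw
    rw [mem_filter, mem_pmVecs] at hv hw
    exact neg_two_mul_lt_dotZ hv.1 hw.1 hv.2 hw.2
  · exact Nat.eq_of_mul_eq_mul_left hn (mul_card_pmVecs_star.trans hA.symm)
  · rintro m ⟨F, hF, hdot, rfl⟩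
    refine Nat.le_of_mul_le_mul_left ?_ hn
    rw [hA]
    exact mul_card_le_mul_card_pmVecs hlk.le hn1 (by omega)
      (fun v hv => mem_pmVecs.2 (hF v hv)) hdot
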